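/- lim_{n→∞} n^{1/2} · (3 − E[I(2,n)]) = √π/2, where E[I(2,n)] is the expected number of elimination rounds in G(2,n) conditional on strict-dominance solvability. -/

import Mathlib

open Finset Filter

noncomputable section

/-- Row action `i` is strictly dominated in the restricted game with Row actions `X`
and Column actions `Y`, for Row payoff matrix `R`. -/
def RowDomIn {m n : ℕ} (R : Fin m → Fin n → ℝ) (X : Finset (Fin m)) (Y : Finset (Fin n))
    (i : Fin m) : Prop :=
  ∃ i' ∈ X, ∀ j ∈ Y, R i j < R i' j

/-- Column action `j` is strictly dominated in the restricted game with Row actions `X`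
and Column actions `Y`, for Column payoff matrix `C`. -/
def ColDomIn {m n : ℕ} (C : Fin m → Fin n → ℝ) (X : Finset (Fin m)) (Y : Finset (Fin n))
    (j : Fin n) : Prop :=
  ∃ j' ∈ Y, ∀ i ∈ X, C i j < C i j'

open Classical in
/-- One round of iterated elimination: simultaneously delete every strictly dominated
action of both players in the current restricted game. -/
def elimStep {m n : ℕ} (R C : Fin m → Fin n → ℝ)
    (p : Finset (Fin m) × Finset (Fin n)) : Finset (Fin m) × Finset (Fin n) :=
  (p.1.filter fun i => ¬ RowDomIn R p.1 p.2 i,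
   p.2.filter fun j => ¬ ColDomIn C p.1 p.2 j)

/-- Surviving actions of the subgame `(p.1, p.2)` after iterated elimination of strictly
dominated actions (iterating `m + n` times surely reaches the fixed point). -/
def survivorsFrom {m n : ℕ} (R C : Fin m → Fin n → ℝ)
    (p : Finset (Fin m) × Finset (Fin n)) : Finset (Fin m) × Finset (Fin n) :=
  (elimStep R C)^[m + n] p

/-- The subgame `(p.1, p.2)` is strict-dominance solvable: exactly one action of each
player survives iterated elimination of strictly dominated actions. -/
def SolvableFrom {m n : ℕ} (R C : Fin m → Fin n → ℝ)
    (p : Finset (Fin m) × Finset (Fin n)) : Prop :=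
  (survivorsFrom R C p).1.card = 1 ∧ (survivorsFrom R C p).2.card = 1

/-- Surviving actions of the full game after iterated elimination. -/
def survivors {m n : ℕ} (R C : Fin m → Fin n → ℝ) : Finset (Fin m) × Finset (Fin n) :=
  survivorsFrom R C (Finset.univ, Finset.univ)

/-- The game is strict-dominance solvable. -/
def Solvable {m n : ℕ} (R C : Fin m → Fin n → ℝ) : Prop :=
  SolvableFrom R C (Finset.univ, Finset.univ)

/-- The number of rounds performed by the iterated elimination procedure:
the least `k` such that round `k + 1` deletes nothing more. -/
def elimRounds {m n : ℕ} (R C : Fin m → Fin n → ℝ) : ℕ :=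
  sInf {k | (elimStep R C)^[k + 1] (Finset.univ, Finset.univ)
          = (elimStep R C)^[k] (Finset.univ, Finset.univ)}

/-- Sample space of the random game `G(m,n)`: for each Column action an i.i.d. uniform
permutation giving Row's ordinal payoffs in that column, and for each Row action an
i.i.d. uniform permutation giving Column's ordinal payoffs in that row. -/
abbrev Omega (m n : ℕ) := (Fin n → Equiv.Perm (Fin m)) × (Fin m → Equiv.Perm (Fin n))

/-- Row's payoff matrix of the realized game. -/
def RPay {m n : ℕ} (ω : Omega m n) : Fin m → Fin n → ℝ := fun i j => ((ω.1 j) i : ℕ)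

/-- Column's payoff matrix of the realized game. -/
def CPay {m n : ℕ} (ω : Omega m n) : Fin m → Fin n → ℝ := fun i j => ((ω.2 i) j : ℕ)

/-- Probability of an event under the uniform distribution on `Omega m n`
(i.e. all `m + n` permutations uniform and mutually independent). -/
def Pr {m n : ℕ} (E : Set (Omega m n)) : ℝ :=
  (E.toFinite.toFinset.card : ℝ) / (Fintype.card (Omega m n) : ℝ)

open Classical in
/-- Number of Row actions that are not strictly dominated. -/
def UR {m n : ℕ} (ω : Omega m n) : ℕ :=
  (Finset.univ.filter fun i => ¬ RowDomIn (RPay ω) Finset.univ Finset.univ i).card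

open Classical in
/-- Number of Column actions that are not strictly dominated. -/
def UC {m n : ℕ} (ω : Omega m n) : ℕ :=
  (Finset.univ.filter fun j => ¬ ColDomIn (CPay ω) Finset.univ Finset.univ j).card

/-- Number of Row actions surviving iterated elimination. -/
def SR {m n : ℕ} (ω : Omega m n) : ℕ := (survivors (RPay ω) (CPay ω)).1.card

/-- Number of Column actions surviving iterated elimination. -/
def SC {m n : ℕ} (ω : Omega m n) : ℕ := (survivors (RPay ω) (CPay ω)).2.card

/-- The realized game is strict-dominance solvable. -/
def GameSolvable {m n : ℕ} (ω : Omega m n) : Prop := Solvable (RPay ω) (CPay ω)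

/-- Number of rounds of the iterated elimination procedure in the realized game. -/
def GameRounds {m n : ℕ} (ω : Omega m n) : ℕ := elimRounds (RPay ω) (CPay ω)

/-- `π(m,n)`: probability that the random game `G(m,n)` is strict-dominance solvable. -/
def probSolvable (m n : ℕ) : ℝ := Pr {ω : Omega m n | GameSolvable ω}

/-- Expected number of Column's strictly undominated actions, `E[U^C(m,n)]`. -/
def expUC (m n : ℕ) : ℝ :=
  (∑ ω : Omega m n, (UC ω : ℝ)) / (Fintype.card (Omega m n) : ℝ)

/-- Expected number of Column actions surviving iterated elimination, `E[S^C(m,n)]`. -/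
def expSC (m n : ℕ) : ℝ :=
  (∑ ω : Omega m n, (SC ω : ℝ)) / (Fintype.card (Omega m n) : ℝ)

open Classical in
/-- `E[I(m,n)]`: expected number of elimination rounds conditional on the game being
strict-dominance solvable. -/
def condExpRounds (m n : ℕ) : ℝ :=
  (∑ ω : Omega m n, if GameSolvable ω then (GameRounds ω : ℝ) else 0) /
    (∑ ω : Omega m n, if GameSolvable ω then (1 : ℝ) else 0)

/-- Unsigned Stirling numbers of the first kind. -/
def stirling1 : ℕ → ℕ → ℕ
  | 0, 0 => 1
  | 0, _ + 1 => 0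
  | _ + 1, 0 => 0
  | n + 1, k + 1 => n * stirling1 n (k + 1) + stirling1 n k

end

theorem wallis_mul_centralBinom_sq (n : ℕ) :
    Real.Wallis.W n * ((2 * n + 1) * ((n.centralBinom : ℝ) / 4 ^ n) ^ 2) = 1 := by
  induction n with
  | zero => simp [Real.Wallis.W]
  | succ n ih =>
    have h : ((n + 1).centralBinom : ℝ) = 2 * (2 * n + 1) * n.centralBinom / (n + 1) := by
      rw [eq_div_iff (by positivity), mul_comm]
      exact_mod_cast Nat.succ_mul_centralBinom_succ n
    rw [Real.Wallis.W_succ, h]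
    refine Eq.trans ?_ ih
    push_cast
    field_simp
    ring

theorem tendsto_sqrt_mul_centralBinom :
    Tendsto (fun n : ℕ => Real.sqrt n * ((n.centralBinom : ℝ) / 4 ^ n)) atTop
      (nhds (1 / Real.sqrt Real.pi)) := by
  have h1 : Tendsto (fun n : ℕ => Real.sqrt (((n : ℝ) / (2 * n + 1)) / Real.Wallis.W n)) atTop
      (nhds (Real.sqrt ((1 / 2) / (Real.pi / 2)))) := by
    refine (Tendsto.div ?_ Real.tendsto_prod_pi_div_two (by positivity)).sqrt
    have h2 : Tendsto (fun n : ℕ => (1 / 2 : ℝ) * (1 - 1 / (2 * (n : ℝ) + 1))) atTop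
        (nhds ((1 / 2) * (1 - 0))) := by
      refine (tendsto_const_nhds.sub ?_).const_mul _
      refine tendsto_const_nhds.div_atTop ?_
      exact tendsto_atTop_add_const_right _ _
        (tendsto_natCast_atTop_atTop.const_mul_atTop two_pos)
    simp only [sub_zero, mul_one] at h2
    refine h2.congr fun n => ?_
    field_simp
    ring
  rw [show (1 / 2 : ℝ) / (Real.pi / 2) = 1 / Real.pi by field_simp, Real.sqrt_div zero_le_one,
    Real.sqrt_one] at h1
  refine h1.congr fun n => ?_
  have hW := Real.Wallis.W_pos n
  have h3 : ((n : ℝ) / (2 * n + 1)) / Real.Wallis.W n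
      = n * ((n.centralBinom : ℝ) / 4 ^ n) ^ 2 := by
    rw [div_div, div_eq_iff (by positivity)]
    linear_combination (-(n : ℝ)) * wallis_mul_centralBinom_sq n
  rw [h3, Real.sqrt_mul (Nat.cast_nonneg n), Real.sqrt_sq (by positivity)]

/-- The positions `i` of right-to-left maxima of the permutation `e`. -/
def rightToLeftMaxima {n : ℕ} (e : Equiv.Perm (Fin n)) : Finset (Fin n) :=
  univ.filter fun i => ∀ j, i < j → e j < e i

/-- The permutation of `Fin (n + 1)` with first value `p` and whose remaining values are in the
same relative order as those of `e`. -/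
def consPerm {n : ℕ} (q : Fin (n + 1) × Equiv.Perm (Fin n)) : Equiv.Perm (Fin (n + 1)) :=
  ((finSuccEquiv' 0).trans (Equiv.optionCongr q.2)).trans (finSuccEquiv' q.1).symm

@[simp] theorem consPerm_zero {n : ℕ} (q : Fin (n + 1) × Equiv.Perm (Fin n)) :
    consPerm q 0 = q.1 := by
  simp [consPerm]

@[simp] theorem consPerm_succ {n : ℕ} (q : Fin (n + 1) × Equiv.Perm (Fin n)) (i : Fin n) :
    consPerm q i.succ = q.1.succAbove (q.2 i) := by
  have : finSuccEquiv' (0 : Fin (n + 1)) i.succ = some i := by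
    rw [← Fin.succAbove_zero]
    exact finSuccEquiv'_succAbove 0 i
  simp [consPerm, this]

theorem consPerm_bijective (n : ℕ) : Function.Bijective (consPerm (n := n)) := by
  rw [Fintype.bijective_iff_injective_and_card]
  refine ⟨?_, by simp [Fintype.card_perm, Nat.factorial_succ]⟩
  rintro ⟨p, e⟩ ⟨p', e'⟩ h
  have h0 : p = p' := by simpa using Equiv.congr_fun h 0
  subst h0
  refine Prod.ext rfl (Equiv.ext fun i => ?_)
  simpa using Equiv.congr_fun h i.succ

theorem card_rightToLeftMaxima_consPerm {n : ℕ} (p : Fin (n + 1)) (e : Equiv.Perm (Fin n)) :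
    (rightToLeftMaxima (consPerm (p, e))).card
      = (rightToLeftMaxima e).card + if p = Fin.last n then 1 else 0 := by
  have hz : (∀ j : Fin (n + 1), 0 < j → consPerm (p, e) j < consPerm (p, e) 0)
      ↔ p = Fin.last n := by
    simp only [Fin.forall_fin_succ, consPerm_zero, consPerm_succ, Fin.succ_pos, true_implies,
      lt_irrefl, false_implies, true_and]
    constructor
    · intro h
      by_contra hp
      have hlt : p.val < n := lt_of_le_of_ne (Nat.lt_succ_iff.mp p.isLt) fun h => hp (Fin.ext h)
      have h' := h (e.symm ⟨p.val, hlt⟩)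
      simp only [Equiv.apply_symm_apply] at h'
      rw [Fin.succAbove_lt_iff_castSucc_lt] at h'
      simp at h'
    · rintro rfl i
      simp [Fin.castSucc_lt_last]
  simp only [rightToLeftMaxima, Finset.card_filter, Fin.sum_univ_succ, hz]
  rw [add_comm]
  congr 1
  refine Finset.sum_congr rfl fun i _ => ?_
  simp [Fin.forall_fin_succ, Fin.succ_lt_succ_iff]

theorem sum_card_rightToLeftMaxima_succ (n : ℕ) (f : ℕ → ℝ) :
    ∑ e : Equiv.Perm (Fin (n + 1)), f (rightToLeftMaxima e).card
      = ∑ e : Equiv.Perm (Fin n),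
          (n * f (rightToLeftMaxima e).card + f ((rightToLeftMaxima e).card + 1)) := by
  rw [← (Equiv.ofBijective _ (consPerm_bijective n)).sum_comp, Fintype.sum_prod_type_right]
  refine Finset.sum_congr rfl fun e _ => ?_
  simp only [Equiv.ofBijective_apply, card_rightToLeftMaxima_consPerm]
  rw [Fin.sum_univ_castSucc]
  simp [(Fin.castSucc_lt_last _).ne]

theorem sum_half_pow_card_rightToLeftMaxima (n : ℕ) :
    ∑ e : Equiv.Perm (Fin n), (1 / 2 : ℝ) ^ (rightToLeftMaxima e).card
      = n.centralBinom / 4 ^ n * n.factorial := by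
  induction n with
  | zero => simp [rightToLeftMaxima]
  | succ n ih =>
    rw [sum_card_rightToLeftMaxima_succ n fun k => (1 / 2 : ℝ) ^ k]
    have h : ((n + 1).centralBinom : ℝ) = 2 * (2 * n + 1) * n.centralBinom / (n + 1) := by
      rw [eq_div_iff (by positivity), mul_comm]
      exact_mod_cast Nat.succ_mul_centralBinom_succ n
    simp only [pow_succ, Finset.sum_add_distrib, ← Finset.mul_sum,
      ← Finset.sum_mul, ih, h, Nat.factorial_succ]
    push_cast
    field_simp
    ring

theorem rightToLeftMaxima_nonempty {n : ℕ} (e : Equiv.Perm (Fin (n + 1))) :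
    (rightToLeftMaxima e).Nonempty :=
  ⟨Fin.last n, by simp [rightToLeftMaxima, Fin.not_lt.mpr (Fin.le_last _)]⟩

theorem sum_card_rightToLeftMaxima_eq_one (n : ℕ) :
    ∑ e : Equiv.Perm (Fin (n + 1)), (if (rightToLeftMaxima e).card = 1 then (1 : ℝ) else 0)
      = n.factorial := by
  induction n with
  | zero => simp [rightToLeftMaxima]
  | succ n ih =>
    rw [sum_card_rightToLeftMaxima_succ (n + 1) fun k => if k = 1 then (1 : ℝ) else 0]
    rw [Finset.sum_add_distrib, ← Finset.mul_sum, ih]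
    simp [(rightToLeftMaxima_nonempty _).ne_empty, Nat.factorial_succ]

theorem mem_elimStep_fst {m n : ℕ} (R C : Fin m → Fin n → ℝ)
    (p : Finset (Fin m) × Finset (Fin n)) (i : Fin m) :
    i ∈ (elimStep R C p).1 ↔ i ∈ p.1 ∧ ¬ RowDomIn R p.1 p.2 i := by
  simp [elimStep]

theorem mem_elimStep_snd {m n : ℕ} (R C : Fin m → Fin n → ℝ)
    (p : Finset (Fin m) × Finset (Fin n)) (j : Fin n) :
    j ∈ (elimStep R C p).2 ↔ j ∈ p.2 ∧ ¬ ColDomIn C p.1 p.2 j := by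
  simp [elimStep]

theorem elimRounds_eq_succ {m n k : ℕ} {R C : Fin m → Fin n → ℝ}
    (hfix : (elimStep R C)^[k + 2] (univ, univ) = (elimStep R C)^[k + 1] (univ, univ))
    (hne : (elimStep R C)^[k + 1] (univ, univ) ≠ (elimStep R C)^[k] (univ, univ)) :
    elimRounds R C = k + 1 := by
  refine le_antisymm (Nat.sInf_le hfix) (le_csInf ⟨_, hfix⟩ fun l hl => ?_)
  by_contra! hlt
  apply hne
  rw [Set.mem_ofPred_eq, Function.iterate_succ_apply'] at hl
  have hstay : ∀ d, (elimStep R C)^[d + l] (univ, univ) = (elimStep R C)^[l] (univ, univ) := by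
    intro d
    rw [Function.iterate_add_apply]
    exact Function.IsFixedPt.iterate hl d
  have h1 := hstay (k + 1 - l)
  have h2 := hstay (k - l)
  rw [Nat.sub_add_cancel (by omega)] at h1 h2
  rw [h1, h2]

theorem survivors_eq_iterate {m n k : ℕ} {R C : Fin m → Fin n → ℝ} (hk : k ≤ m + n)
    (hfix : elimStep R C ((elimStep R C)^[k] (univ, univ)) = (elimStep R C)^[k] (univ, univ)) :
    survivors R C = (elimStep R C)^[k] (univ, univ) := by
  rw [survivors, survivorsFrom, show m + n = (m + n - k) + k by omega,
    Function.iterate_add_apply]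
  exact Function.IsFixedPt.iterate hfix _

/-- The columns of a two-row game that are not strictly dominated. -/
def undominatedCols {n : ℕ} (c : Fin 2 → Equiv.Perm (Fin n)) : Finset (Fin n) :=
  univ.filter fun j => ∀ j', ∃ i, c i j' ≤ c i j

/-- The same row is preferred by the Row player in all columns of `Y`. -/
def UnanimousOn {n : ℕ} (r : Fin n → Equiv.Perm (Fin 2)) (Y : Finset (Fin n)) : Prop :=
  ∃ i, ∀ j ∈ Y, r j i = 1

instance {n : ℕ} (r : Fin n → Equiv.Perm (Fin 2)) (Y : Finset (Fin n)) :
    Decidable (UnanimousOn r Y) := by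
  unfold UnanimousOn
  infer_instance

theorem undominatedCols_nonempty {n : ℕ} (hn : 0 < n) (c : Fin 2 → Equiv.Perm (Fin n)) :
    (undominatedCols c).Nonempty := by
  refine ⟨(c 0).symm ⟨n - 1, by omega⟩, ?_⟩
  simp only [undominatedCols, mem_filter, mem_univ, true_and]
  intro j'
  refine ⟨0, ?_⟩
  rw [Equiv.apply_symm_apply, Fin.le_def]
  have := (c 0 j').isLt
  simp only
  omega

theorem perm_fin_two_lt_iff (p : Equiv.Perm (Fin 2)) (i i' : Fin 2) :
    p i < p i' ↔ i ≠ i' ∧ p i' = 1 := by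
  revert p i i'
  decide

theorem rowDomIn_univ_iff {n : ℕ} (ω : Omega 2 n) {Y : Finset (Fin n)} (hY : Y.Nonempty)
    (i : Fin 2) :
    RowDomIn (RPay ω) univ Y i ↔ ∃ i', i ≠ i' ∧ ∀ j ∈ Y, ω.1 j i' = 1 := by
  obtain ⟨y, hy⟩ := hY
  simp only [RowDomIn, RPay, mem_univ, true_and, Nat.cast_lt, Fin.val_fin_lt,
    perm_fin_two_lt_iff]
  exact exists_congr fun i' =>
    ⟨fun h => ⟨(h y hy).1, fun j hj => (h j hj).2⟩, fun h j hj => ⟨h.1, h.2 j hj⟩⟩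

theorem elimStep_fst_of_unanimous {n : ℕ} (ω : Omega 2 n) {Y : Finset (Fin n)}
    (hY : Y.Nonempty) {i : Fin 2} (h : ∀ j ∈ Y, ω.1 j i = 1) :
    (elimStep (RPay ω) (CPay ω) (univ, Y)).1 = {i} := by
  ext i'
  rw [mem_elimStep_fst, rowDomIn_univ_iff ω hY]
  simp only [mem_univ, true_and, mem_singleton]
  obtain ⟨y, hy⟩ := hY
  constructor
  · intro h'
    by_contra hne
    exact h' ⟨i, hne, h⟩
  · rintro rfl ⟨k, hne, hk⟩
    exact hne ((ω.1 y).injective ((h y hy).trans (hk y hy).symm))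

theorem elimStep_fst_of_not_unanimous {n : ℕ} (ω : Omega 2 n) {Y : Finset (Fin n)}
    (hY : Y.Nonempty) (h : ¬ UnanimousOn ω.1 Y) :
    (elimStep (RPay ω) (CPay ω) (univ, Y)).1 = univ := by
  ext i'
  rw [mem_elimStep_fst, rowDomIn_univ_iff ω hY]
  simp only [mem_univ, true_and, iff_true]
  rintro ⟨i, -, hi⟩
  exact h ⟨i, hi⟩

theorem elimStep_univ_snd {n : ℕ} (ω : Omega 2 n) :
    (elimStep (RPay ω) (CPay ω) (univ, univ)).2 = undominatedCols ω.2 := by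
  ext j
  rw [mem_elimStep_snd]
  simp [ColDomIn, CPay, undominatedCols, imp_iff_not_or]

theorem elimStep_undominatedCols_snd {n : ℕ} (ω : Omega 2 n) :
    (elimStep (RPay ω) (CPay ω) (univ, undominatedCols ω.2)).2 = undominatedCols ω.2 := by
  ext j
  rw [mem_elimStep_snd]
  simp only [and_iff_left_iff_imp]
  rintro hj ⟨j', -, h⟩
  rw [undominatedCols, mem_filter] at hj
  obtain ⟨i, hi⟩ := hj.2 j'
  have := h i (mem_univ i)
  simp only [CPay, Nat.cast_lt, Fin.val_fin_lt] at this
  exact absurd hi (not_le.mpr this)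

theorem elimStep_singleton_row {m n : ℕ} (ω : Omega m n) (i : Fin m) {Y : Finset (Fin n)}
    (hY : Y.Nonempty) :
    ∃ j ∈ Y, elimStep (RPay ω) (CPay ω) ({i}, Y) = ({i}, {j}) := by
  obtain ⟨j, hj, hmax⟩ := Y.exists_max_image (ω.2 i) hY
  refine ⟨j, hj, Prod.ext ?_ ?_⟩
  · ext i'
    rw [mem_elimStep_fst]
    simp only [mem_singleton, and_iff_left_iff_imp]
    rintro rfl ⟨k, hk, h⟩
    obtain rfl := mem_singleton.mp hk
    exact lt_irrefl _ (h j hj)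
  · ext j'
    rw [mem_elimStep_snd]
    simp only [ColDomIn, CPay, mem_singleton, forall_eq, Nat.cast_lt, Fin.val_fin_lt]
    constructor
    · rintro ⟨hj', h⟩
      by_contra hne
      exact h ⟨j, hj, lt_of_le_of_ne (hmax j' hj') fun h => hne ((ω.2 i).injective h)⟩
    · rintro rfl
      exact ⟨hj, fun ⟨k, hk, h⟩ => absurd (hmax k hk) (not_le.mpr h)⟩

theorem elimStep_singleton {m n : ℕ} (ω : Omega m n) (i : Fin m) (j : Fin n) :
    elimStep (RPay ω) (CPay ω) ({i}, {j}) = ({i}, {j}) := by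
  obtain ⟨k, hk, h⟩ := elimStep_singleton_row ω i (singleton_nonempty j)
  rwa [mem_singleton.mp hk] at h

theorem solvable_of_iterate_eq_singleton {m n k : ℕ} (ω : Omega m n) {i : Fin m} {j : Fin n}
    (hk : k + 1 ≤ m + n)
    (h : (elimStep (RPay ω) (CPay ω))^[k + 1] (univ, univ) = ({i}, {j}))
    (hne : (elimStep (RPay ω) (CPay ω))^[k] (univ, univ) ≠ ({i}, {j})) :
    GameSolvable ω ∧ GameRounds ω = k + 1 := by
  have hfix := elimStep_singleton ω i j
  rw [← h, ← Function.iterate_succ_apply' (elimStep (RPay ω) (CPay ω))] at hfix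
  refine ⟨?_, elimRounds_eq_succ hfix (by rw [h]; exact hne.symm)⟩
  have hs := survivors_eq_iterate hk ((Function.iterate_succ_apply' _ _ _).symm.trans hfix)
  rw [h] at hs
  change (survivors (RPay ω) (CPay ω)).1.card = 1 ∧ (survivors (RPay ω) (CPay ω)).2.card = 1
  simp [hs]

theorem not_gameSolvable_of_not_unanimous {n : ℕ} (hn : 0 < n) (ω : Omega 2 n)
    (h : ¬ UnanimousOn ω.1 (undominatedCols ω.2)) : ¬ GameSolvable ω := by
  have hU := undominatedCols_nonempty hn ω.2
  have hn' : (univ : Finset (Fin n)).Nonempty := ⟨⟨0, hn⟩, mem_univ _⟩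
  have h1 : (elimStep (RPay ω) (CPay ω))^[1] (univ, univ) = (univ, undominatedCols ω.2) :=
    Prod.ext (elimStep_fst_of_not_unanimous ω hn' fun ⟨i, hi⟩ =>
        h ⟨i, fun j _ => hi j (mem_univ j)⟩)
      (elimStep_univ_snd ω)
  have hs := survivors_eq_iterate (R := RPay ω) (C := CPay ω) (k := 1) (by omega) (by
    rw [h1]
    exact Prod.ext (elimStep_fst_of_not_unanimous ω hU h) (elimStep_undominatedCols_snd ω))
  rw [h1] at hs
  rintro ⟨hc, -⟩
  change (survivors (RPay ω) (CPay ω)).1.card = 1 at hc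
  simp [hs] at hc

theorem solvable_and_rounds_of_unanimous {n : ℕ} (hn : 0 < n) (ω : Omega 2 n)
    (h : UnanimousOn ω.1 (undominatedCols ω.2)) :
    GameSolvable ω ∧ (3 : ℝ) - GameRounds ω
      = (if (undominatedCols ω.2).card = 1 then 1 else 0)
        + if UnanimousOn ω.1 univ then 1 else 0 := by
  have hU := undominatedCols_nonempty hn ω.2
  have hn' : (univ : Finset (Fin n)).Nonempty := ⟨⟨0, hn⟩, mem_univ _⟩
  have huniv : ∀ i : Fin 2, (univ : Finset (Fin 2)) ≠ {i} := by decide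
  by_cases hall : UnanimousOn ω.1 univ
  · rw [if_pos hall]
    obtain ⟨i, hi⟩ := hall
    have h1 : (elimStep (RPay ω) (CPay ω))^[1] (univ, univ) = ({i}, undominatedCols ω.2) :=
      Prod.ext (elimStep_fst_of_unanimous ω hn' hi) (elimStep_univ_snd ω)
    split_ifs with hcard
    · obtain ⟨j, hj⟩ := card_eq_one.mp hcard
      rw [hj] at h1
      obtain ⟨hs, hr⟩ := solvable_of_iterate_eq_singleton ω (by omega) h1
        fun he => huniv i (congrArg Prod.fst he)
      refine ⟨hs, ?_⟩
      rw [hr]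
      norm_num
    · obtain ⟨j, -, h2⟩ := elimStep_singleton_row ω i hU
      rw [← h1, ← Function.iterate_succ_apply' (elimStep (RPay ω) (CPay ω))] at h2
      obtain ⟨hs, hr⟩ := solvable_of_iterate_eq_singleton ω (by omega) h2 (by
        rw [h1]
        exact fun he => hcard (card_eq_one.mpr ⟨j, congrArg Prod.snd he⟩))
      refine ⟨hs, ?_⟩
      rw [hr]
      norm_num
  · have h1 : (elimStep (RPay ω) (CPay ω))^[1] (univ, univ) = (univ, undominatedCols ω.2) :=
      Prod.ext (elimStep_fst_of_not_unanimous ω hn' hall) (elimStep_univ_snd ω)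
    obtain ⟨i, hi⟩ := h
    have h2 : (elimStep (RPay ω) (CPay ω))^[2] (univ, univ) = ({i}, undominatedCols ω.2) := by
      rw [Function.iterate_succ_apply', h1]
      exact Prod.ext (elimStep_fst_of_unanimous ω hU hi) (elimStep_undominatedCols_snd ω)
    rw [if_neg hall]
    split_ifs with hcard
    · obtain ⟨j, hj⟩ := card_eq_one.mp hcard
      rw [hj] at h2
      obtain ⟨hs, hr⟩ := solvable_of_iterate_eq_singleton ω (by omega) h2 (by
        rw [h1]
        exact fun he => huniv i (congrArg Prod.fst he))
      refine ⟨hs, ?_⟩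
      rw [hr]
      norm_num
    · obtain ⟨j, -, h3⟩ := elimStep_singleton_row ω i hU
      rw [← h2, ← Function.iterate_succ_apply' (elimStep (RPay ω) (CPay ω))] at h3
      obtain ⟨hs, hr⟩ := solvable_of_iterate_eq_singleton ω (by omega) h3 (by
        rw [h2]
        exact fun he => hcard (card_eq_one.mpr ⟨j, congrArg Prod.snd he⟩))
      refine ⟨hs, ?_⟩
      rw [hr]
      norm_num

theorem gameSolvable_iff {n : ℕ} (hn : 0 < n) (ω : Omega 2 n) :
    GameSolvable ω ↔ UnanimousOn ω.1 (undominatedCols ω.2) :=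
  ⟨not_imp_not.mp (not_gameSolvable_of_not_unanimous hn ω),
    fun h => (solvable_and_rounds_of_unanimous hn ω h).1⟩

open Classical in
theorem ite_gameSolvable_three_sub_rounds {n : ℕ} (hn : 0 < n) (ω : Omega 2 n) :
    (if GameSolvable ω then (3 : ℝ) - GameRounds ω else 0)
      = (if (undominatedCols ω.2).card = 1 then 1 else 0)
        + if UnanimousOn ω.1 univ then 1 else 0 := by
  by_cases h : UnanimousOn ω.1 (undominatedCols ω.2)
  · obtain ⟨hs, hr⟩ := solvable_and_rounds_of_unanimous hn ω h
    rw [if_pos hs, hr]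
  · rw [if_neg (not_gameSolvable_of_not_unanimous hn ω h), if_neg, if_neg, add_zero]
    · exact fun ⟨i, hi⟩ => h ⟨i, fun j _ => hi j (mem_univ j)⟩
    · intro hcard
      obtain ⟨j, hj⟩ := card_eq_one.mp hcard
      refine h ⟨(ω.1 j).symm 1, fun j' hj' => ?_⟩
      rw [hj, mem_singleton] at hj'
      rw [hj', Equiv.apply_symm_apply]

theorem card_undominatedCols_eq {n : ℕ} (s e : Equiv.Perm (Fin n)) :
    (undominatedCols ![s, e * s]).card = (rightToLeftMaxima e).card := by
  refine Finset.card_equiv s fun j => ?_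
  simp only [undominatedCols, rightToLeftMaxima, mem_filter, mem_univ, true_and, Fin.exists_fin_two,
    Matrix.cons_val_zero, Matrix.cons_val_one, Equiv.Perm.mul_apply]
  rw [← s.forall_congr_right (q := fun b => s j < b → e b < e (s j))]
  refine forall_congr' fun j' => ?_
  rw [← not_lt, ← imp_iff_not_or]
  refine imp_congr_right fun hlt => ⟨fun h => lt_of_le_of_ne h fun h' => ?_, le_of_lt⟩
  exact hlt.ne' (e.injective h')

theorem sum_card_undominatedCols (n : ℕ) (f : ℕ → ℝ) :
    ∑ c : Fin 2 → Equiv.Perm (Fin n), f (undominatedCols c).card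
      = n.factorial * ∑ e : Equiv.Perm (Fin n), f (rightToLeftMaxima e).card := by
  rw [← (finTwoArrowEquiv (Equiv.Perm (Fin n))).symm.sum_comp, Fintype.sum_prod_type]
  have h : ∀ s : Equiv.Perm (Fin n), ∑ t : Equiv.Perm (Fin n),
      f (undominatedCols ((finTwoArrowEquiv (Equiv.Perm (Fin n))).symm (s, t))).card
        = ∑ e : Equiv.Perm (Fin n), f (rightToLeftMaxima e).card := by
    intro s
    rw [← Equiv.sum_comp (Equiv.mulRight s)]
    refine Finset.sum_congr rfl fun e _ => ?_
    rw [← card_undominatedCols_eq s e]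
    rfl
  simp only [h, Finset.sum_const, Finset.card_univ, Fintype.card_perm, Fintype.card_fin,
    nsmul_eq_mul]

theorem sum_card_undominatedCols_eq_one (n : ℕ) :
    ∑ c : Fin 2 → Equiv.Perm (Fin (n + 1)),
        (if (undominatedCols c).card = 1 then (1 : ℝ) else 0)
      = (n + 1).factorial * n.factorial := by
  rw [sum_card_undominatedCols (n + 1) fun k => if k = 1 then 1 else 0,
    sum_card_rightToLeftMaxima_eq_one]

theorem sum_unanimousOn {n : ℕ} {Y : Finset (Fin n)} (hY : Y.Nonempty) :
    ∑ r : Fin n → Equiv.Perm (Fin 2), (if UnanimousOn r Y then (1 : ℝ) else 0)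
      = 2 ^ (n + 1) * (1 / 2) ^ Y.card := by
  obtain ⟨y, hy⟩ := hY
  have hsplit : ∀ r : Fin n → Equiv.Perm (Fin 2), (if UnanimousOn r Y then (1 : ℝ) else 0)
      = ∑ i : Fin 2, if ∀ j ∈ Y, r j i = 1 then 1 else 0 := by
    intro r
    split_ifs with h
    · obtain ⟨i, hi⟩ := h
      rw [Finset.sum_eq_single i, if_pos hi]
      · intro i' _ hne
        rw [if_neg]
        exact fun h' => hne ((r y).injective ((h' y hy).trans (hi y hy).symm))
      · simp
    · refine (Finset.sum_eq_zero fun i _ => if_neg fun h' => h ⟨i, h'⟩).symm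
  have hcount : ∀ i : Fin 2, ∑ r : Fin n → Equiv.Perm (Fin 2),
      (if ∀ j ∈ Y, r j i = 1 then (1 : ℝ) else 0) = 2 ^ n * (1 / 2) ^ Y.card := by
    intro i
    have hi : ∑ p : Equiv.Perm (Fin 2), (if p i = 1 then (1 : ℝ) else 0) = 1 := by
      rw [Finset.sum_boole]
      have : #{p : Equiv.Perm (Fin 2) | p i = 1} = 1 := by
        revert i
        decide
      simp [this]
    calc ∑ r : Fin n → Equiv.Perm (Fin 2), (if ∀ j ∈ Y, r j i = 1 then (1 : ℝ) else 0)
        = ∑ r : Fin n → Equiv.Perm (Fin 2), ∏ j, if j ∈ Y → r j i = 1 then (1 : ℝ) else 0 := by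
          refine Finset.sum_congr rfl fun r _ => ?_
          rw [Finset.prod_ite_zero]
          simp
      _ = ∏ j, ∑ p : Equiv.Perm (Fin 2), if j ∈ Y → p i = 1 then (1 : ℝ) else 0 :=
          (Fintype.prod_sum fun j (p : Equiv.Perm (Fin 2)) =>
            if j ∈ Y → p i = 1 then (1 : ℝ) else 0).symm
      _ = ∏ j, 2 * (if j ∈ Y then (1 / 2 : ℝ) else 1) := by
          refine Finset.prod_congr rfl fun j _ => ?_
          by_cases hj : j ∈ Y
          · simp only [hj, true_imp_iff, if_true, hi]
            norm_num
          · simp [hj, Fintype.card_perm]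
      _ = 2 ^ n * (1 / 2) ^ Y.card := by
          rw [Finset.prod_mul_distrib, Finset.prod_ite]
          simp
  simp_rw [hsplit]
  rw [Finset.sum_comm]
  simp only [hcount, Finset.sum_const, Finset.card_univ, Fintype.card_fin, nsmul_eq_mul]
  push_cast
  ring

open Classical in
theorem sum_gameSolvable {n : ℕ} (hn : 0 < n) :
    ∑ ω : Omega 2 n, (if GameSolvable ω then (1 : ℝ) else 0)
      = 2 ^ (n + 1) * (n.factorial : ℝ) ^ 2 * (n.centralBinom / 4 ^ n) := by
  rw [Fintype.sum_prod_type_right]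
  calc _ = ∑ c : Fin 2 → Equiv.Perm (Fin n),
        2 ^ (n + 1) * (1 / 2 : ℝ) ^ (undominatedCols c).card := by
        refine Finset.sum_congr rfl fun c _ => ?_
        rw [← sum_unanimousOn (undominatedCols_nonempty hn c)]
        refine Finset.sum_congr rfl fun r _ => ?_
        simp only [gameSolvable_iff hn]
    _ = _ := by
        rw [sum_card_undominatedCols n fun k => 2 ^ (n + 1) * (1 / 2 : ℝ) ^ k, ← Finset.mul_sum,
          sum_half_pow_card_rightToLeftMaxima]
        ring

open Classical in
theorem sum_gameSolvable_three_sub_rounds (n : ℕ) :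
    ∑ ω : Omega 2 (n + 1), (if GameSolvable ω then (3 : ℝ) - GameRounds ω else 0)
      = 2 ^ (n + 1) * (n + 1).factorial * n.factorial + 2 * ((n + 1).factorial : ℝ) ^ 2 := by
  simp only [ite_gameSolvable_three_sub_rounds (Nat.add_one_pos n)]
  rw [Fintype.sum_prod_type_right]
  change ∑ c : Fin 2 → Equiv.Perm (Fin (n + 1)), ∑ r : Fin (n + 1) → Equiv.Perm (Fin 2),
    ((if (undominatedCols c).card = 1 then (1 : ℝ) else 0)
      + if UnanimousOn r univ then 1 else 0) = _
  simp only [Finset.sum_add_distrib, sum_unanimousOn univ_nonempty]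
  rw [Finset.sum_comm, sum_card_undominatedCols_eq_one]
  simp only [Finset.sum_const, Finset.card_univ, Fintype.card_fin, nsmul_eq_mul,
    Fintype.card_fun, Fintype.card_perm, Nat.factorial_two]
  have h : (2 : ℝ) ^ (n + 1 + 1) * (1 / 2) ^ (n + 1) = 2 := by
    rw [pow_succ, mul_right_comm, ← mul_pow]
    norm_num
  push_cast
  rw [h]
  ring

theorem three_sub_condExpRounds {n : ℕ} (hn : 0 < n) :
    3 - condExpRounds 2 n
      = (1 + n * 2 * (1 / 2) ^ n) / (2 * n * (n.centralBinom / 4 ^ n)) := by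
  classical
  have hc : (0 : ℝ) < n.centralBinom := by exact_mod_cast n.centralBinom_pos
  have hf : (0 : ℝ) < n.factorial := by exact_mod_cast n.factorial_pos
  have hden := sum_gameSolvable hn
  have hnum : ∑ ω : Omega 2 n, (if GameSolvable ω then (GameRounds ω : ℝ) else 0)
      = 3 * ∑ ω : Omega 2 n, (if GameSolvable ω then (1 : ℝ) else 0)
        - ∑ ω : Omega 2 n, (if GameSolvable ω then (3 : ℝ) - GameRounds ω else 0) := by
    rw [Finset.mul_sum, ← Finset.sum_sub_distrib]
    refine Finset.sum_congr rfl fun ω _ => ?_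
    split_ifs <;> ring
  obtain ⟨n, rfl⟩ := Nat.exists_eq_succ_of_ne_zero hn.ne'
  rw [condExpRounds, hnum, hden, sum_gameSolvable_three_sub_rounds]
  have hf' : (0 : ℝ) < n.factorial := by exact_mod_cast n.factorial_pos
  simp only [Nat.succ_eq_add_one, Nat.factorial_succ, one_div, inv_pow] at *
  push_cast
  field_simp
  ring

/-- `lim_(n→∞) n^(1/2) · (3 − E[I(2,n)]) = √π/2`. -/
theorem stmt7 :
    Filter.Tendsto (fun n : ℕ => Real.sqrt n * (3 - condExpRounds 2 n))
      Filter.atTop (nhds (Real.sqrt Real.pi / 2)) := by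
  have hpi : Real.sqrt Real.pi ≠ 0 := (Real.sqrt_pos.mpr Real.pi_pos).ne'
  have hgeom : Tendsto (fun n : ℕ => (n : ℝ) * (1 / 2) ^ n) atTop (nhds 0) :=
    tendsto_self_mul_const_pow_of_lt_one (by norm_num) (by norm_num)
  have hlim : Tendsto (fun n : ℕ => (1 + 2 * ((n : ℝ) * (1 / 2) ^ n)) /
      (2 * (Real.sqrt n * ((n.centralBinom : ℝ) / 4 ^ n)))) atTop
      (nhds ((1 + 2 * 0) / (2 * (1 / Real.sqrt Real.pi)))) :=
    ((hgeom.const_mul 2).const_add 1).div (tendsto_sqrt_mul_centralBinom.const_mul 2)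
      (by positivity)
  rw [show (1 + 2 * 0) / (2 * (1 / Real.sqrt Real.pi)) = Real.sqrt Real.pi / 2 by
    field_simp; ring] at hlim
  refine hlim.congr' ?_
  filter_upwards [eventually_gt_atTop 0] with n hn
  have hc : (0 : ℝ) < n.centralBinom := by exact_mod_cast n.centralBinom_pos
  have hs : 0 < Real.sqrt n := Real.sqrt_pos.mpr (by exact_mod_cast hn)
  have hsq : Real.sqrt n * Real.sqrt n = n := Real.mul_self_sqrt (Nat.cast_nonneg n)
  rw [three_sub_condExpRounds hn, ← mul_div_assoc (Real.sqrt n) (1 + n * 2 * (1 / 2) ^ n),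
    div_eq_div_iff (by positivity) (by positivity)]
  linear_combination (-(2 * ((n.centralBinom : ℝ) / 4 ^ n) * (1 + 2 * n * (1 / 2) ^ n))) * hsq
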